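/- arXiv:2001.07584 — 2 statements merged into one kernel-verified Lean document; each statement's English description precedes it below -/
import Mathlib

section
/- Every G_χ-orbit on V contains a point of the form f_Σ for some segmentation Σ of Ω; that is, for every f ∈ V there exist a segmentation Σ and an element g ∈ G_χ = P_χ × G_0 with g·f = f_Σ. -/
open Matrix

noncomputable section

/-- The indexing set `Ω = {(i,j) : 1 ≤ i ≤ m, 1 ≤ j ≤ v_i}` for the standard basis vectors of
`⊕ ℂ^{v_i}`; levels are indexed by `Fin (m'+1)` (so `m = m'+1`) and `d` is the dimension
vector (with `d (Fin.last m') = n`). -/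
abbrev QOmega (m' : ℕ) (d : Fin (m' + 1) → ℕ) := Σ i : Fin (m' + 1), Fin (d i)

/-- A point of `V = ⊕_{i=1}^{m-1} Hom(ℂ^{v_i}, ℂ^{v_{i+1}})`, as a family of matrices. -/
abbrev QRep (m' : ℕ) (d : Fin (m' + 1) → ℕ) :=
  ∀ i : Fin m', Matrix (Fin (d i.succ)) (Fin (d i.castSucc)) ℂ

/-- An element of `GL_{v_1} × ⋯ × GL_{v_{m-1}} × GL_n`. -/
abbrev QGroup (m' : ℕ) (d : Fin (m' + 1) → ℕ) := ∀ i : Fin (m' + 1), GL (Fin (d i)) ℂ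

/-- The base-change action of the group on the space of quiver representations. -/
def qAct {m' : ℕ} {d : Fin (m' + 1) → ℕ} (g : QGroup m' d) (f : QRep m' d) : QRep m' d :=
  fun i => ((g i.succ : Matrix (Fin (d i.succ)) (Fin (d i.succ)) ℂ)) * f i *
    (((g i.castSucc)⁻¹ : GL (Fin (d i.castSucc)) ℂ) : Matrix _ _ ℂ)

/-- Membership in the parabolic `P_χ ⊆ GL_n`: the entries `g_{kl}` with `χ_k > χ_l` vanish. -/
def InParabolic {N : ℕ} (χ : Fin N → ℤ) (A : Matrix (Fin N) (Fin N) ℂ) : Prop :=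
  ∀ k l : Fin N, χ l < χ k → A k l = 0

/-- The set of levels occurring in a subset `S ⊆ Ω`. -/
def levelsOf {m' : ℕ} {d : Fin (m' + 1) → ℕ} (S : Set (QOmega m' d)) : Set (Fin (m' + 1)) :=
  {i | ∃ j : Fin (d i), (⟨i, j⟩ : QOmega m' d) ∈ S}

/-- A subsegment of `Ω`: a set of the form `{(k,j_k),(k+1,j_{k+1}),…,(ℓ,j_ℓ)}`, i.e. a
nonempty subset with at most one element at each level whose set of levels is an interval. -/
def IsSubsegment {m' : ℕ} {d : Fin (m' + 1) → ℕ} (S : Set (QOmega m' d)) : Prop :=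
  S.Nonempty ∧
  (∀ (i : Fin (m' + 1)) (j j' : Fin (d i)),
    (⟨i, j⟩ : QOmega m' d) ∈ S → (⟨i, j'⟩ : QOmega m' d) ∈ S → j = j') ∧
  (∀ i₁ i₂ i₃ : Fin (m' + 1), i₁ ∈ levelsOf S → i₂ ∈ levelsOf S →
    i₁ ≤ i₃ → i₃ ≤ i₂ → i₃ ∈ levelsOf S)

/-- A segmentation of `Ω`: a partition of `Ω` into subsegments. -/
def IsSegmentation {m' : ℕ} {d : Fin (m' + 1) → ℕ} (P : Set (Set (QOmega m' d))) : Prop :=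
  (∀ S ∈ P, IsSubsegment S) ∧ ∀ x : QOmega m' d, ∃! S, S ∈ P ∧ x ∈ S

open Classical in
/-- The quiver representation `f_Σ` attached to a segmentation: `f(b_{i,j}) = b_{i+1,j'}` if
`(i,j)` and `(i+1,j')` lie in a common subsegment, and `f(b_{i,j}) = 0` otherwise. -/
def segRep {m' : ℕ} {d : Fin (m' + 1) → ℕ} (P : Set (Set (QOmega m' d))) : QRep m' d :=
  fun i => Matrix.of fun j' j =>
    if ∃ S ∈ P, (⟨i.castSucc, j⟩ : QOmega m' d) ∈ S ∧ (⟨i.succ, j'⟩ : QOmega m' d) ∈ S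
    then (1 : ℂ) else 0

/-- Two segmentations define the same `χ`-flavored multisegment: there is a bijection between
their subsegments matching the underlying segments, and matching subsegments ending at the top
level only when the corresponding flavors (entries of `χ`) agree. -/
def SameMultisegment {m' : ℕ} {d : Fin (m' + 1) → ℕ} (χ : Fin (d (Fin.last m')) → ℤ)
    (P P' : Set (Set (QOmega m' d))) : Prop :=
  ∃ φ : P ≃ P', ∀ S : P,
    levelsOf (S : Set (QOmega m' d)) = levelsOf ((φ S : Set (QOmega m' d))) ∧
    ∀ j j' : Fin (d (Fin.last m')),
      (⟨Fin.last m', j⟩ : QOmega m' d) ∈ (S : Set (QOmega m' d)) →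
      (⟨Fin.last m', j'⟩ : QOmega m' d) ∈ ((φ S : Set (QOmega m' d))) → χ j = χ j'

/-- `f` and `f'` lie in the same `G_χ = P_χ × G_0` orbit. -/
def SameOrbit {m' : ℕ} {d : Fin (m' + 1) → ℕ} (χ : Fin (d (Fin.last m')) → ℤ)
    (f f' : QRep m' d) : Prop :=
  ∃ g : QGroup m' d,
    InParabolic χ ((g (Fin.last m') : Matrix (Fin (d (Fin.last m'))) (Fin (d (Fin.last m'))) ℂ)) ∧
    qAct g f = f'

/-- A set `S` of vectors is adapted to a family `C` of subspaces if every `G ∈ C` meets the span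
of `S` in the span of `S ∩ G`. -/
def IsAdapted {K V : Type*} [Field K] [AddCommGroup V] [Module K V]
    (C : Set (Submodule K V)) (S : Set V) : Prop :=
  ∀ G ∈ C, G ⊓ Submodule.span K S ≤ Submodule.span K (S ∩ G)

/-- A basis, given as a set of vectors, adapted to the family `C` of subspaces. -/
structure IsAdaptedBasis {K V : Type*} [Field K] [AddCommGroup V] [Module K V]
    (C : Set (Submodule K V)) (S : Set V) : Prop where
  linearIndepOn : LinearIndepOn K id S
  adapted : IsAdapted C S
  span_eq_top : Submodule.span K S = ⊤

/-- In finite dimension, a linearly independent set adapted to a chain of subspaces extends to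
an adapted basis. -/
theorem IsAdapted.exists_isAdaptedBasis {K V : Type*} [Field K] [AddCommGroup V] [Module K V]
    [FiniteDimensional K V] {C : Set (Submodule K V)} (hC : IsChain (· ≤ ·) C) {S : Set V}
    (hS : LinearIndepOn K id S) (hA : IsAdapted C S) : ∃ T, S ⊆ T ∧ IsAdaptedBasis C T := by
  induction hW : Submodule.span K S using WellFoundedGT.induction generalizing S with
  | ind W ih =>
    by_cases htop : Submodule.span K S = ⊤
    · exact ⟨S, subset_rfl, hS, hA, htop⟩
    obtain ⟨F, ⟨hFC, hFS⟩, hmin⟩ := wellFounded_lt.has_min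
      {F | F ∈ insert ⊤ C ∧ ¬ F ≤ Submodule.span K S} ⟨⊤, by simpa using htop⟩
    obtain ⟨x, hxF, hxS⟩ := SetLike.not_le_iff_exists.mp hFS
    have hsub : S ⊆ insert x S := Set.subset_insert x S
    have hC' : IsChain (· ≤ ·) (insert ⊤ C) := hC.insert fun b _ _ => Or.inr le_top
    have hA' : IsAdapted C (insert x S) := by
      rintro G hG y ⟨hyG, hy⟩
      have hmono : Submodule.span K (S ∩ G) ≤ Submodule.span K (insert x S ∩ G) :=
        Submodule.span_mono (Set.inter_subset_inter_left _ hsub)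
      by_cases hGS : G ≤ Submodule.span K S
      · exact hmono (hA G hG ⟨hyG, hGS hyG⟩)
      have hFG : F ≤ G := by
        rcases hC'.total hFC (Set.mem_insert_of_mem _ hG) with h | h
        · exact h
        · by_contra hne
          exact hmin G ⟨Set.mem_insert_of_mem _ hG, hGS⟩ (lt_of_le_not_ge h hne)
      obtain ⟨a, z, hz, rfl⟩ := Submodule.mem_span_insert.mp hy
      have hxG : a • x ∈ G := G.smul_mem a (hFG hxF)
      refine add_mem (Submodule.smul_mem _ a (Submodule.subset_span ⟨Set.mem_insert x S, hFG hxF⟩))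
        (hmono (hA G hG ⟨(G.add_mem_iff_right hxG).mp hyG, hz⟩))
    have hlt : W < Submodule.span K (insert x S) := by
      rw [← hW]
      refine lt_of_le_not_ge (Submodule.span_mono hsub) fun h => hxS ?_
      exact h (Submodule.subset_span (Set.mem_insert x S))
    obtain ⟨T, hT, hT'⟩ := ih _ hlt (hS.id_insert hxS) hA' rfl
    exact ⟨T, hsub.trans hT, hT'⟩

section Map

variable {K V W : Type*} [Field K] [AddCommGroup V] [Module K V] [AddCommGroup W] [Module K W]

theorem IsAdaptedBasis.disjoint_span_diff_ker {C : Set (Submodule K V)} {S : Set V}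
    (hS : IsAdaptedBasis C S) {f : V →ₗ[K] W} (hf : LinearMap.ker f ∈ C) :
    Disjoint (Submodule.span K (S \ LinearMap.ker f)) (LinearMap.ker f) := by
  have hli := hS.linearIndepOn
  rw [← Set.inter_union_sdiff S (LinearMap.ker f : Set V)] at hli
  have hd := ((linearIndepOn_id_union_iff
    (Set.disjoint_sdiff_right.mono_left Set.inter_subset_right)).mp hli).2.2
  refine hd.symm.mono_right fun x hx => hS.adapted _ hf ⟨hx, ?_⟩
  simp [hS.span_eq_top]

/-- The nonzero images of an adapted basis under a linear map are part of an adapted basis. -/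
theorem IsAdaptedBasis.exists_image_subset [FiniteDimensional K W]
    {C : Set (Submodule K V)} {D : Set (Submodule K W)} {S : Set V}
    (hS : IsAdaptedBasis C S) {f : V →ₗ[K] W} (hf : LinearMap.ker f ∈ C)
    (hD : IsChain (· ≤ ·) D) (hCD : ∀ G ∈ D, G.comap f ∈ C) :
    ∃ T, f '' (S \ LinearMap.ker f) ⊆ T ∧ IsAdaptedBasis D T := by
  refine IsAdapted.exists_isAdaptedBasis hD
    ((hS.linearIndepOn.mono Set.sdiff_subset).image (hS.disjoint_span_diff_ker hf)) ?_
  rintro G hG y ⟨hyG, hy⟩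
  rw [Submodule.span_image] at hy
  obtain ⟨x, -, rfl⟩ := hy
  have hx : x ∈ Submodule.span K (S ∩ G.comap f) :=
    hS.adapted _ (hCD G hG) ⟨hyG, by simp [hS.span_eq_top]⟩
  have hfx := Submodule.mem_map_of_mem (f := f) hx
  rw [Submodule.map_span] at hfx
  refine Submodule.span_le.mpr ?_ hfx
  rintro _ ⟨s, ⟨hsS, hsG⟩, rfl⟩
  by_cases h0 : f s = 0
  · simp [h0]
  · exact Submodule.subset_span ⟨⟨s, ⟨hsS, h0⟩, rfl⟩, hsG⟩

theorem IsAdaptedBasis.injOn_diff_ker {C : Set (Submodule K V)} {S : Set V}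
    (hS : IsAdaptedBasis C S) {f : V →ₗ[K] W} (hf : LinearMap.ker f ∈ C) :
    Set.InjOn f (S \ LinearMap.ker f) :=
  LinearMap.injOn_of_disjoint_ker Submodule.subset_span (hS.disjoint_span_diff_ker hf)

theorem exists_isAdaptedBasis [FiniteDimensional K V] {C : Set (Submodule K V)}
    (hC : IsChain (· ≤ ·) C) : ∃ T, IsAdaptedBasis C T := by
  obtain ⟨T, -, hT⟩ := IsAdapted.exists_isAdaptedBasis (S := ∅) hC (linearIndepOn_empty K id)
    (fun G _ => by simp)
  exact ⟨T, hT⟩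

end Map

/-- The subspace of vectors in `K ^ n` supported on the first `k` coordinates. -/
def stdFlag (K : Type*) [Field K] (n k : ℕ) : Submodule K (Fin n → K) where
  carrier := {x | ∀ l : Fin n, k ≤ l → x l = 0}
  zero_mem' := by simp
  add_mem' := fun hx hy l hl => by simp [hx l hl, hy l hl]
  smul_mem' := fun c x hx l hl => by simp [hx l hl]

theorem stdFlag_mono (K : Type*) [Field K] (n : ℕ) : Monotone (stdFlag K n) :=
  fun _ _ h _ hx l hl => hx l (h.trans hl)

theorem IsAdaptedBasis.nonempty_equiv {K : Type*} [Field K] {n : ℕ}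
    {C : Set (Submodule K (Fin n → K))} {S : Set (Fin n → K)} (hS : IsAdaptedBasis C S) :
    Nonempty (Fin n ≃ S) :=
  ⟨(Pi.basisFun K (Fin n)).indexEquiv
    (Module.Basis.mk (v := ((↑) : S → Fin n → K)) hS.linearIndepOn (by simp [hS.span_eq_top]))⟩

theorem IsAdaptedBasis.isUnit_matrix {K : Type*} [Field K] {n : ℕ}
    {C : Set (Submodule K (Fin n → K))} {S : Set (Fin n → K)} (hS : IsAdaptedBasis C S)
    (e : Fin n ≃ S) : IsUnit (Matrix.of fun k j => (e j : Fin n → K) k) := by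
  rw [← Matrix.linearIndependent_cols_iff_isUnit]
  have hli : LinearIndependent K ((↑) : S → Fin n → K) := hS.linearIndepOn
  exact hli.comp e e.injective

/-- A basis adapted to the standard flag can be ordered into a triangular one. -/
theorem IsAdaptedBasis.exists_equiv_triangular {K : Type*} [Field K] {n : ℕ}
    {C : Set (Submodule K (Fin n → K))} {S : Set (Fin n → K)} (hS : IsAdaptedBasis C S)
    (hC : ∀ k, stdFlag K n k ∈ C) :
    ∃ e : Fin n ≃ S, ∀ k l : Fin n, k < l → (e k : Fin n → K) l = 0 := by
  have hex : ∀ k : Fin n, ∃ s : S, (s : Fin n → K) ∈ stdFlag K n (k + 1) ∧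
      (s : Fin n → K) ∉ stdFlag K n k := by
    intro k
    by_contra! hk
    have hmem : Pi.single k (1 : K) ∈ stdFlag K n (k + 1) := fun l hl =>
      Pi.single_eq_of_ne (fun h => by subst h; omega) _
    have h1 := hS.adapted _ (hC (k + 1)) ⟨hmem, by simp [hS.span_eq_top]⟩
    have h2 : Submodule.span K (S ∩ stdFlag K n (k + 1)) ≤ stdFlag K n k :=
      Submodule.span_le.mpr fun s hs => hk ⟨s, hs.1⟩ hs.2
    simpa using h2 h1 k le_rfl
  choose e he he' using hex
  have hlt : ∀ k l, k < l → e k ≠ e l := fun k l hkl h =>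
    he' l (h ▸ stdFlag_mono K n (show (k : ℕ) + 1 ≤ l from hkl) (he k))
  have hinj : Function.Injective e := fun k l h => by
    rcases lt_trichotomy k l with hkl | hkl | hkl
    · exact absurd h (hlt k l hkl)
    · exact hkl
    · exact absurd h.symm (hlt l k hkl)
  obtain ⟨c⟩ := hS.nonempty_equiv
  have hsurj := (Finite.injective_iff_surjective_of_equiv c).mp hinj
  exact ⟨Equiv.ofBijective e ⟨hinj, hsurj⟩, fun k l hkl => he k l hkl⟩

section Chain

variable {K : Type*} [Field K] {m : ℕ} {V : Fin (m + 1) → Type*} [∀ i, AddCommGroup (V i)]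
  [∀ i, Module K (V i)]

/-- Pulling a chain of subspaces back along a sequence of linear maps, adding the kernels. -/
theorem exists_isChain_comap (φ : ∀ i : Fin m, V i.castSucc →ₗ[K] V i.succ)
    {C₀ : Set (Submodule K (V (Fin.last m)))} (hC₀ : IsChain (· ≤ ·) C₀) :
    ∃ C : ∀ i, Set (Submodule K (V i)), (∀ i, IsChain (· ≤ ·) (C i)) ∧ C₀ ⊆ C (Fin.last m) ∧
      (∀ i : Fin m, LinearMap.ker (φ i) ∈ C i.castSucc) ∧
      ∀ i : Fin m, ∀ G ∈ C i.succ, G.comap (φ i) ∈ C i.castSucc := by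
  have hins : ∀ i (D : Set (Submodule K (V i))), IsChain (· ≤ ·) D →
      IsChain (· ≤ ·) (insert ⊥ D) := fun i D hD => hD.insert fun _ _ _ => Or.inl bot_le
  let C : ∀ i, Set (Submodule K (V i)) :=
    Fin.reverseInduction (motive := fun i => Set (Submodule K (V i))) (insert ⊥ C₀)
      fun i D => insert ⊥ ((fun G => G.comap (φ i)) '' D)
  have hlast : C (Fin.last m) = insert ⊥ C₀ := Fin.reverseInduction_last
  have hstep : ∀ i : Fin m, C i.castSucc = insert ⊥ ((fun G => G.comap (φ i)) '' C i.succ) :=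
    fun i => Fin.reverseInduction_castSucc i
  have hbot : ∀ i, ⊥ ∈ C i := fun i => by
    induction i using Fin.lastCases with
    | last => rw [hlast]; exact Set.mem_insert _ _
    | cast i => rw [hstep]; exact Set.mem_insert _ _
  have hcomap : ∀ i : Fin m, ∀ G ∈ C i.succ, G.comap (φ i) ∈ C i.castSucc := fun i G hG => by
    rw [hstep]
    exact Set.mem_insert_of_mem _ ⟨G, hG, rfl⟩
  refine ⟨C, fun i => ?_, hlast ▸ Set.subset_insert _ _, fun i => hcomap i ⊥ (hbot _), hcomap⟩
  induction i using Fin.reverseInduction with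
  | last => rw [hlast]; exact hins _ _ hC₀
  | cast i ih =>
    rw [hstep]
    exact hins _ _ (ih.image_of_map_rel _ _ _ fun _ _ h => Submodule.comap_mono h)

/-- A sequence of linear maps, with a chain of subspaces of the last space, has bases of all the
spaces which are mapped into one another up to zero, the last one being adapted to the chain. -/
theorem exists_isAdaptedBasis_sequence [∀ i, FiniteDimensional K (V i)]
    (φ : ∀ i : Fin m, V i.castSucc →ₗ[K] V i.succ)
    {C₀ : Set (Submodule K (V (Fin.last m)))} (hC₀ : IsChain (· ≤ ·) C₀) :
    ∃ (C : ∀ i, Set (Submodule K (V i))) (S : ∀ i, Set (V i)), C₀ ⊆ C (Fin.last m) ∧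
      (∀ i, IsAdaptedBasis (C i) (S i)) ∧
      ∀ i : Fin m, φ i '' (S i.castSucc \ LinearMap.ker (φ i)) ⊆ S i.succ ∧
        Set.InjOn (φ i) (S i.castSucc \ LinearMap.ker (φ i)) := by
  obtain ⟨C, hC, hlast, hker, hcomap⟩ := exists_isChain_comap φ hC₀
  choose T hT hT' using fun (i : Fin m) (S : {S // IsAdaptedBasis (C i.castSucc) S}) =>
    S.2.exists_image_subset (hker i) (hC i.succ) (hcomap i)
  let S : ∀ i, {S // IsAdaptedBasis (C i) S} :=
    Fin.induction (motive := fun i => {S // IsAdaptedBasis (C i) S})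
      ⟨_, (exists_isAdaptedBasis (hC 0)).choose_spec⟩ fun i S => ⟨T i S, hT' i S⟩
  exact ⟨C, fun i => (S i).1, hlast, fun i => (S i).2,
    fun i => ⟨hT i (S i.castSucc), (S i.castSucc).2.injOn_diff_ker (hker i)⟩⟩

end Chain

section Segmentation

variable {m : ℕ} {d : Fin (m + 1) → ℕ} (r : ∀ i : Fin m, Fin (d i.castSucc) → Fin (d i.succ) → Prop)

/-- The successor relation on `Ω` given by relations between consecutive levels. -/
inductive QNext : QOmega m d → QOmega m d → Prop
  | mk (i : Fin m) (j : Fin (d i.castSucc)) (j' : Fin (d i.succ)) (h : r i j j') :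
    QNext ⟨i.castSucc, j⟩ ⟨i.succ, j'⟩

variable {r}

theorem QNext.level {x y : QOmega m d} (h : QNext r x y) : (y.1 : ℕ) = x.1 + 1 := by
  cases h
  simp

theorem QNext.level_le_and_eq {x y : QOmega m d}
    (h : Relation.ReflTransGen (QNext r) x y) : x.1 ≤ y.1 ∧ (x.1 = y.1 → x = y) := by
  induction h with
  | refl => simp
  | tail _ hyz ih =>
    have h1 := hyz.level
    have h2 : (x.1 : ℕ) ≤ _ := ih.1
    exact ⟨Fin.le_def.mpr (by omega), fun h => by have := congrArg Fin.val h; omega⟩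

theorem QNext.exists_of_level_le {x y : QOmega m d} (h : Relation.ReflTransGen (QNext r) x y)
    {k : Fin (m + 1)} (hxk : x.1 ≤ k) (hky : k ≤ y.1) :
    ∃ z : QOmega m d, z.1 = k ∧ Relation.ReflTransGen (QNext r) x z := by
  induction h with
  | refl => exact ⟨x, le_antisymm hxk hky, .refl⟩
  | @tail y z hxy hyz ih =>
    have h1 := hyz.level
    rcases le_or_gt k y.1 with h | h
    · exact ih h
    · exact ⟨z, Fin.ext (by rw [Fin.le_def] at hky; rw [Fin.lt_def] at h; omega), hxy.tail hyz⟩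

theorem QNext.mk_iff {i : Fin m} {j : Fin (d i.castSucc)} {j' : Fin (d i.succ)} :
    QNext r ⟨i.castSucc, j⟩ ⟨i.succ, j'⟩ ↔ r i j j' := by
  refine ⟨fun h => ?_, .mk i j j'⟩
  generalize hx : (⟨i.castSucc, j⟩ : QOmega m d) = x at h
  generalize hy : (⟨i.succ, j'⟩ : QOmega m d) = y at h
  cases h with
  | mk i₁ j₁ j₁' h =>
    obtain rfl : i = i₁ := Fin.castSucc_injective _ (congrArg Sigma.fst hx)
    obtain rfl : j = j₁ := by simpa using hx
    obtain rfl : j' = j₁' := by simpa using hy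
    exact h

/-- Relations between consecutive levels which are partial injective functions come from a
segmentation. -/
theorem exists_isSegmentation
    (hr : ∀ i j j₁ j₂, r i j j₁ → r i j j₂ → j₁ = j₂)
    (hl : ∀ i j₁ j₂ j, r i j₁ j → r i j₂ j → j₁ = j₂) :
    ∃ P : Set (Set (QOmega m d)), IsSegmentation P ∧ ∀ i j j',
      (∃ S ∈ P, (⟨i.castSucc, j⟩ : QOmega m d) ∈ S ∧ (⟨i.succ, j'⟩ : QOmega m d) ∈ S) ↔
        r i j j' := by
  have hR : Relator.RightUnique (QNext r) := by
    intro x y z hxy hxz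
    obtain ⟨i, j, j₁, h⟩ := hxy
    generalize hx : (⟨i.castSucc, j⟩ : QOmega m d) = x at hxz
    cases hxz with
    | mk i₁ j₂ j₃ h' =>
      obtain rfl : i = i₁ := Fin.castSucc_injective _ (congrArg Sigma.fst hx)
      obtain rfl : j = j₂ := by simpa using hx
      rw [hr i j j₁ j₃ h h']
  have hL : Relator.RightUnique (Function.swap (QNext r)) := by
    intro x y z hxy hxz
    obtain ⟨i, j, j₁, h⟩ := hxy
    generalize hx : (⟨i.succ, j₁⟩ : QOmega m d) = x at hxz
    cases hxz with
    | mk i₁ j₂ j₃ h' =>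
      obtain rfl : i = i₁ := Fin.succ_injective _ (congrArg Sigma.fst hx)
      obtain rfl : j₁ = j₃ := by simpa using hx
      rw [hl i j j₂ j₁ h h']
  let s : Setoid (QOmega m d) :=
    { r := fun x y => Relation.ReflTransGen (QNext r) x y ∨ Relation.ReflTransGen (QNext r) y x
      iseqv :=
        { refl := fun x => .inl .refl
          symm := Or.symm
          trans := by
            rintro x y z (hxy | hyx) (hyz | hzy)
            · exact .inl (hxy.trans hyz)
            · exact (Relation.ReflTransGen.total_of_right_unique hL hxy.swap hzy.swap).symm.imp
                Relation.reflTransGen_swap.mp Relation.reflTransGen_swap.mp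
            · exact Relation.ReflTransGen.total_of_right_unique hR hyx hyz
            · exact .inr (hzy.trans hyx) } }
  refine ⟨s.classes, ⟨?_, Setoid.classes_eqv_classes⟩, fun i j j' => ?_⟩
  · rintro S hS
    have hrel : ∀ {x y}, x ∈ S → y ∈ S → s x y := fun hx hy =>
      s.rel_iff_exists_classes.mpr ⟨S, hS, hx, hy⟩
    have hmem : ∀ {x y}, x ∈ S → s x y → y ∈ S := fun hx hxy => by
      obtain ⟨S', hS', hx', hy'⟩ := s.rel_iff_exists_classes.mp hxy
      rwa [Setoid.eq_of_mem_classes hS hx hS' hx']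
    refine ⟨Set.nonempty_iff_ne_empty.mpr fun h => Setoid.empty_notMem_classes (h ▸ hS),
      fun i j j' h h' => ?_, ?_⟩
    · rcases hrel h h' with h | h
      · simpa using (QNext.level_le_and_eq h).2 rfl
      · simpa using ((QNext.level_le_and_eq h).2 rfl).symm
    · rintro i₁ i₂ i₃ ⟨j₁, h₁⟩ ⟨j₂, h₂⟩ h13 h32
      rcases hrel h₁ h₂ with h | h
      · obtain ⟨⟨_, j⟩, rfl, hz⟩ := QNext.exists_of_level_le h h13 h32
        exact ⟨j, hmem h₁ (.inl hz)⟩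
      · obtain rfl : i₃ = i₁ := le_antisymm (h32.trans (QNext.level_le_and_eq h).1) h13
        exact ⟨j₁, h₁⟩
  · rw [← s.rel_iff_exists_classes, ← QNext.mk_iff (r := r)]
    refine ⟨?_, fun h => .inl (.single h)⟩
    rintro (h | h)
    · rcases h.cases_head with h | ⟨z, hz, hzy⟩
      · have := congrArg (fun x : QOmega m d => (x.1 : ℕ)) h
        simp at this
      · have hlev := hz.level
        rwa [(QNext.level_le_and_eq hzy).2 (Fin.ext (by simp [hlev]))] at hz
    · have := (QNext.level_le_and_eq h).1
      simp [Fin.le_def] at this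

end Segmentation

/-- Every `G_χ`-orbit on `V` contains a point of the form `f_Σ` for a segmentation `Σ` of `Ω`. -/
theorem orbit_contains_segmentation_point (m' : ℕ) (hm : 1 ≤ m') (d : Fin (m' + 1) → ℕ)
    (χ : Fin (d (Fin.last m')) → ℤ) (hχ : Monotone χ) (f : QRep m' d) :
    ∃ P : Set (Set (QOmega m' d)), IsSegmentation P ∧
      ∃ g : QGroup m' d,
        InParabolic χ
          ((g (Fin.last m') : Matrix (Fin (d (Fin.last m'))) (Fin (d (Fin.last m'))) ℂ)) ∧
        qAct g f = segRep P := by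
  obtain ⟨C, S, hlast, hS, hφ⟩ := exists_isAdaptedBasis_sequence (m := m')
    (V := fun i => Fin (d i) → ℂ) (fun i => (f i).mulVecLin)
    (C₀ := Set.range (stdFlag ℂ (d (Fin.last m')))) (stdFlag_mono ℂ _).isChain_range
  -- the last basis is ordered triangularly, the others arbitrarily
  have he : ∀ i, ∃ e : Fin (d i) ≃ S i, i = Fin.last m' →
      ∀ k l : Fin (d i), k < l → (e k : Fin (d i) → ℂ) l = 0 := by
    intro i
    by_cases hi : i = Fin.last m'
    · subst hi
      obtain ⟨e, he⟩ := (hS (Fin.last m')).exists_equiv_triangular fun k => hlast ⟨k, rfl⟩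
      exact ⟨e, fun _ => he⟩
    · obtain ⟨e⟩ := (hS i).nonempty_equiv
      exact ⟨e, fun h => absurd h hi⟩
  choose e he using he
  let M : ∀ i, Matrix (Fin (d i)) (Fin (d i)) ℂ := fun i => Matrix.of fun k j => (e i j).1 k
  have hS0 : ∀ i j, (e i j).1 ≠ 0 := fun i j h0 =>
    LinearIndepOn.zero_notMem_image (hS i).linearIndepOn ⟨_, (e i j).2, h0⟩
  have hM : ∀ i, IsUnit (M i) := fun i =>
    (hS i).isUnit_matrix (e i)
  obtain ⟨P, hP, hPr⟩ := exists_isSegmentation (m := m') (d := d)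
    (r := fun i j j' => f i *ᵥ (e i.castSucc j).1 = (e i.succ j').1)
    (fun i j j₁ j₂ h₁ h₂ => (e i.succ).injective (Subtype.ext (h₁.symm.trans h₂)))
    (fun i j₁ j₂ j h₁ h₂ => by
      refine (e i.castSucc).injective (Subtype.ext ((hφ i).2 ⟨(e i.castSucc j₁).2, ?_⟩
        ⟨(e i.castSucc j₂).2, ?_⟩ (h₁.trans h₂.symm)))
      · exact fun h => hS0 i.succ j (h₁.symm.trans h)
      · exact fun h => hS0 i.succ j (h₂.symm.trans h))
  refine ⟨P, hP, fun i => (hM i).unit⁻¹, ?_, ?_⟩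
  · have hMt : (M (Fin.last m')).BlockTriangular χ := fun k l hkl =>
      he _ rfl l k (hχ.reflect_lt hkl)
    have := (hM (Fin.last m')).invertible
    have hinv := Matrix.blockTriangular_inv_of_blockTriangular hMt
    intro k l hkl
    rw [Matrix.coe_units_inv]
    exact hinv hkl
  · funext i
    have hfM : f i * M i.castSucc = M i.succ * segRep P i := by
      ext k j
      change (f i *ᵥ (e i.castSucc j).1) k = _
      simp only [Matrix.mul_apply, segRep, Matrix.of_apply, hPr, mul_ite, mul_one, mul_zero]
      by_cases h0 : f i *ᵥ (e i.castSucc j).1 = 0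
      · simp only [h0, (hS0 i.succ _).symm, if_false, Finset.sum_const_zero, Pi.zero_apply]
      · obtain ⟨j', hj'⟩ := (e i.succ).surjective
          ⟨_, (hφ i).1 ⟨_, ⟨(e i.castSucc j).2, h0⟩, rfl⟩⟩
        have hj : f i *ᵥ (e i.castSucc j).1 = (e i.succ j').1 := by rw [hj']; rfl
        have heq : ∀ j₁, (e i.succ j').1 = (e i.succ j₁).1 ↔ j' = j₁ := fun j₁ => by
          rw [Subtype.coe_inj, (e i.succ).injective.eq_iff]
        simp only [hj, heq, Finset.sum_ite_eq, Finset.mem_univ, if_true]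
        rfl
    refine (Matrix.mul_assoc _ (f i) (M i.castSucc)).trans ?_
    refine (congrArg _ hfM).trans ?_
    refine (Matrix.mul_assoc _ (M i.succ) (segRep P i)).symm.trans ?_
    exact (congrArg (fun A => A * segRep P i) (hM i.succ).unit.inv_mul).trans (Matrix.one_mul _)

end
end

section
/- The map Σ ↦ G_χ·f_Σ from segmentations of Ω to G_χ-orbits on V is surjective, and two segmentations Σ, Σ' have G_χ·f_Σ = G_χ·f_{Σ'} if and only if they have the same χ-flavored multisegment. Hence the G_χ-orbits on V are in bijection with χ-flavored multisegments with dimension vector (v_1,…,v_{m−1},n). -/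
open Matrix

noncomputable section

section LinearAlgebra

variable {K V W : Type*} [Field K] [AddCommGroup V] [Module K V] [AddCommGroup W] [Module K W]

/-- A linearly independent set adapted to a chain of subspaces extends to one that contains a
basis of every member of the chain. -/
theorem exists_adapted_extension [FiniteDimensional K V] (C : Set (Submodule K V))
    (hC : IsChain (· ≤ ·) C) (S : Set V) (hS : LinearIndepOn K id S)
    (hSC : ∀ U ∈ C, U ⊓ Submodule.span K S ≤ Submodule.span K (S ∩ U)) :
    ∃ T, S ⊆ T ∧ LinearIndepOn K id T ∧ ∀ U ∈ C, U ≤ Submodule.span K (T ∩ U) := by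
  let F : Set (Set V) := {T | S ⊆ T ∧ LinearIndepOn K id T ∧
    ∀ U ∈ C, U ⊓ Submodule.span K T ≤ Submodule.span K (T ∩ U)}
  have hF : (Submodule.span K '' F).Nonempty := ⟨_, S, ⟨subset_rfl, hS, hSC⟩, rfl⟩
  obtain ⟨M, ⟨T, ⟨hST, hT, hTC⟩, rfl⟩, hmax⟩ :=
    (wellFounded_gt (α := Submodule K V)).has_min _ hF
  suffices h : ∀ U ∈ C, U ≤ Submodule.span K T from
    ⟨T, hST, hT, fun U hU => (le_inf le_rfl (h U hU)).trans (hTC U hU)⟩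
  by_contra! hne
  obtain ⟨U, ⟨hU, hUT⟩, hmin⟩ := (wellFounded_lt (α := Submodule K V)).has_min
    {U | U ∈ C ∧ ¬ U ≤ Submodule.span K T} hne
  obtain ⟨x, hxU, hxT⟩ := SetLike.not_le_iff_exists.1 hUT
  refine hmax (Submodule.span K (insert x T))
    ⟨_, ⟨hST.trans (Set.subset_insert _ _), hT.id_insert hxT, ?_⟩, rfl⟩ ?_
  · rintro U' hU' y ⟨hyU', hy⟩
    have hmono : Submodule.span K (T ∩ U') ≤ Submodule.span K (insert x T ∩ U') :=
      Submodule.span_mono (Set.inter_subset_inter_left _ (Set.subset_insert _ _))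
    by_cases hle : U ≤ U'
    · obtain ⟨a, z, hz, rfl⟩ := Submodule.mem_span_insert.1 hy
      have hzU' : z ∈ U' := (U'.add_mem_iff_right (U'.smul_mem a (hle hxU))).1 hyU'
      exact add_mem (Submodule.smul_mem _ _
        (Submodule.subset_span ⟨Set.mem_insert _ _, hle hxU⟩)) (hmono (hTC U' hU' ⟨hzU', hz⟩))
    · have hlt : U' < U := lt_of_le_not_ge ((hC.total hU hU').resolve_left hle) hle
      have hU'T : U' ≤ Submodule.span K T := by
        by_contra h
        exact hmin U' ⟨hU', h⟩ hlt
      exact hmono (hTC U' hU' ⟨hyU', hU'T hyU'⟩)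
  · refine lt_of_le_of_ne (Submodule.span_mono (Set.subset_insert _ _)) fun h => hxT ?_
    rw [h]
    exact Submodule.subset_span (Set.mem_insert _ _)

/-- A linearly independent set adapted to the kernel of `f` maps injectively to a linearly
independent set, once the elements of the kernel are removed. -/
theorem linearIndepOn_of_adapted_ker (f : V →ₗ[K] W) (T : Set V) (hT : LinearIndepOn K id T)
    (hker : LinearMap.ker f ≤ Submodule.span K (T ∩ LinearMap.ker f)) :
    LinearIndepOn K f {t ∈ T | f t ≠ 0} := by
  have hR : LinearIndepOn K id {t ∈ T | f t ≠ 0} := hT.mono fun t ht => ht.1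
  have hdisj : Disjoint (Submodule.span K {t ∈ T | f t ≠ 0}) (LinearMap.ker f) := by
    have h := LinearIndependent.disjoint_span_image hT
      (s := {t : T | f t ≠ 0}) (t := {t : T | f t = 0})
      (Set.disjoint_left.2 fun t ht ht' => ht ht')
    refine Disjoint.mono ?_ ?_ h
    · refine Submodule.span_mono ?_
      rintro t ⟨ht, ht'⟩
      exact ⟨⟨t, ht⟩, ht', rfl⟩
    · refine hker.trans (Submodule.span_mono ?_)
      rintro t ⟨ht, ht'⟩
      exact ⟨⟨t, ht⟩, ht', rfl⟩
  have := LinearIndependent.map (f := f) hR (by simpa using hdisj)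
  exact this

/-- A basis adapted to a chain containing the kernel of `f` and the preimages of the members of a
chain `D` can be continued along `f` by a basis adapted to `D`. -/
theorem exists_adapted_image [FiniteDimensional K W] (f : V →ₗ[K] W) (T : Set V)
    (hT : LinearIndepOn K id T) (hspan : Submodule.span K T = ⊤)
    (hker : LinearMap.ker f ≤ Submodule.span K (T ∩ LinearMap.ker f))
    (D : Set (Submodule K W)) (hD : IsChain (· ≤ ·) D)
    (hTD : ∀ U ∈ D, U.comap f ≤ Submodule.span K (T ∩ U.comap f)) :
    ∃ T' : Set W, LinearIndepOn K id T' ∧ Submodule.span K T' = ⊤ ∧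
      (∀ U ∈ D, U ≤ Submodule.span K (T' ∩ U)) ∧ (∀ t ∈ T, f t ≠ 0 → f t ∈ T') ∧
      ∀ t ∈ T, ∀ t' ∈ T, f t ≠ 0 → f t = f t' → t = t' := by
  have hind := linearIndepOn_of_adapted_ker f T hT hker
  obtain ⟨T', hST', hT', hT'D⟩ := exists_adapted_extension (insert ⊤ D)
    (hD.insert fun U _ _ => Or.inr le_top) (f '' {t ∈ T | f t ≠ 0}) hind.id_image (by
      rintro U hU _ ⟨hyU, hy⟩
      have key : ∀ x, f x ∈ U → U.comap f ≤ Submodule.span K (T ∩ U.comap f) →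
          f x ∈ Submodule.span K (f '' {t ∈ T | f t ≠ 0} ∩ U) := by
        intro x hx hU
        have h1 : f x ∈ Submodule.span K (f '' (T ∩ U.comap f)) := by
          rw [Submodule.span_image]
          exact Submodule.mem_map_of_mem (hU hx)
        refine Submodule.span_le.2 ?_ h1
        rintro _ ⟨t, ⟨ht, htU⟩, rfl⟩
        by_cases h0 : f t = 0
        · rw [h0]; exact zero_mem _
        · exact Submodule.subset_span ⟨⟨t, ⟨ht, h0⟩, rfl⟩, htU⟩
      rw [Submodule.span_image] at hy
      obtain ⟨x, -, rfl⟩ := hy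
      rcases hU with rfl | hU
      · exact key x hyU (by simp [hspan])
      · exact key x hyU (hTD U hU))
  refine ⟨T', hT', top_le_iff.1 ?_, fun U hU => hT'D U (Set.mem_insert_of_mem _ hU),
    fun t ht h0 => hST' ⟨t, ⟨ht, h0⟩, rfl⟩, fun t ht t' ht' h0 he =>
    hind.injOn ⟨ht, h0⟩ ⟨ht', he ▸ h0⟩ he⟩
  simpa using hT'D ⊤ (Set.mem_insert _ _)

/-- The subspace of vectors supported on the coordinates satisfying `p`. -/
def coordSubspace (K : Type*) [Field K] {ι : Type*} (p : ι → Prop) : Submodule K (ι → K) where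
  carrier := {v | ∀ j, v j ≠ 0 → p j}
  zero_mem' := by simp
  add_mem' := by
    intro v w hv hw j h
    by_cases h0 : v j = 0
    · exact hw j fun h' => h (by simp [h0, h'])
    · exact hv j h0
  smul_mem' := by
    intro a v hv j h
    exact hv j fun h' => h (by simp [h'])

theorem mem_coordSubspace {ι : Type*} {p : ι → Prop} {v : ι → K} :
    v ∈ coordSubspace K p ↔ ∀ j, v j ≠ 0 → p j := Iff.rfl

open Classical in
theorem finrank_coordSubspace {ι : Type*} [Finite ι] (p : ι → Prop) :
    Module.finrank K (coordSubspace K p) = Nat.card {j // p j} := by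
  have := Fintype.ofFinite ι
  let e : coordSubspace K p ≃ₗ[K] ({j // p j} → K) :=
    { toFun := fun v j => v.1 j
      map_add' := fun _ _ => rfl
      map_smul' := fun _ _ => rfl
      invFun := fun u => ⟨fun j => if h : p j then u ⟨j, h⟩ else 0, fun j hj => by
        by_contra h
        simp [h] at hj⟩
      left_inv := fun v => by
        ext j
        by_cases h : p j
        · simp [h]
        · have : v.1 j = 0 := by
            by_contra h'
            exact h (v.2 j h')
          simp [h, this]
      right_inv := fun u => by
        ext j
        simp [j.2] }
  rw [e.finrank_eq, Module.finrank_fintype_fun_eq_card, Nat.card_eq_fintype_card]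

theorem finrank_eq_card_of_adapted (T : Set V) [Finite T] (hT : LinearIndepOn K id T)
    (U : Submodule K V) (hU : U ≤ Submodule.span K (T ∩ U)) :
    Module.finrank K U = Nat.card {t : T // t.1 ∈ U} := by
  have hUeq : U = Submodule.span K (T ∩ U) :=
    le_antisymm hU (Submodule.span_le.2 Set.inter_subset_right)
  have hfin : Finite ↑(T ∩ (U : Set V)) := Set.Finite.subset (Set.toFinite T) Set.inter_subset_left
  have := Fintype.ofFinite ↑(T ∩ (U : Set V))
  have h := finrank_span_set_eq_card (hT.mono (Set.inter_subset_left (t := (U : Set V))))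
  rw [← hUeq, Set.toFinset_card, ← Nat.card_eq_fintype_card] at h
  rw [h]
  exact Nat.card_congr (Equiv.subtypeSubtypeEquivSubtypeInter (· ∈ T) (· ∈ U)).symm

end LinearAlgebra

section Counting

theorem exists_equiv_of_card_fiber {α β γ : Type*} [Finite α] [Finite β] (u : α → γ) (u' : β → γ)
    (h : ∀ c, Nat.card {x // u x = c} = Nat.card {y // u' y = c}) :
    ∃ e : α ≃ β, ∀ x, u' (e x) = u x :=
  ⟨Equiv.ofFiberEquiv fun c => (Finite.card_eq.1 (h c)).some, Equiv.ofFiberEquiv_map _⟩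

theorem card_fiber_int {α : Type*} [Finite α] (u : α → ℤ) (c : ℤ) :
    Nat.card {x // u x = c} = Nat.card {x // u x ≤ c} - Nat.card {x // u x ≤ c - 1} := by
  have h : {x | u x = c} = {x | u x ≤ c} \ {x | u x ≤ c - 1} := by
    ext x
    simp only [Set.mem_sdiff, Set.mem_ofPred_eq]
    omega
  have hsub : {x | u x ≤ c - 1} ⊆ {x | u x ≤ c} := fun x hx => by
    simp only [Set.mem_ofPred_eq] at hx ⊢
    omega
  have := Set.ncard_sdiff hsub
  rwa [← h] at this

end Counting

section PartialMatching

variable {m' : ℕ} {d : Fin (m' + 1) → ℕ}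

/-- The step relation on `Ω` attached to relations between consecutive levels. -/
def LevelStep (R : ∀ i : Fin m', Fin (d i.castSucc) → Fin (d i.succ) → Prop)
    (x y : QOmega m' d) : Prop :=
  ∃ i j j', R i j j' ∧ x = ⟨i.castSucc, j⟩ ∧ y = ⟨i.succ, j'⟩

variable {R : ∀ i : Fin m', Fin (d i.castSucc) → Fin (d i.succ) → Prop}

theorem LevelStep.level_eq {x y : QOmega m' d} (h : LevelStep R x y) : (y.1 : ℕ) = x.1 + 1 := by
  obtain ⟨i, j, j', -, rfl, rfl⟩ := h
  simp

theorem levelStep_mk {i : Fin m'} {j : Fin (d i.castSucc)} {j' : Fin (d i.succ)} :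
    LevelStep R ⟨i.castSucc, j⟩ ⟨i.succ, j'⟩ ↔ R i j j' := by
  refine ⟨?_, fun h => ⟨i, j, j', h, rfl, rfl⟩⟩
  rintro ⟨i₁, j₁, j₁', h, hx, hy⟩
  obtain ⟨hi, hj⟩ := Sigma.mk.inj hx
  obtain rfl := Fin.castSucc_injective _ hi
  obtain rfl := eq_of_heq hj
  obtain rfl := eq_of_heq (Sigma.mk.inj hy).2
  exact h

theorem levelStep_rightUnique (hr : ∀ i j j₁ j₂, R i j j₁ → R i j j₂ → j₁ = j₂) :
    Relator.RightUnique (LevelStep R) := by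
  rintro _ _ _ ⟨i, j, j₁, h₁, rfl, rfl⟩ ⟨i', j', j₂, h₂, hx, rfl⟩
  obtain ⟨hi, hj⟩ := Sigma.mk.inj hx
  obtain rfl := Fin.castSucc_injective _ hi
  obtain rfl := eq_of_heq hj
  rw [hr _ _ _ _ h₁ h₂]

theorem levelStep_leftUnique (hl : ∀ i j₁ j₂ j, R i j₁ j → R i j₂ j → j₁ = j₂) :
    Relator.RightUnique (Function.swap (LevelStep R)) := by
  rintro _ _ _ ⟨i, j₁, j, h₁, rfl, rfl⟩ ⟨i', j₂, j', h₂, rfl, hx⟩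
  obtain ⟨hi, hj⟩ := Sigma.mk.inj hx
  obtain rfl := Fin.succ_injective _ hi
  obtain rfl := eq_of_heq hj
  rw [hl _ _ _ _ h₁ h₂]

open Relation

theorem levelStep_reflTransGen_le {x y : QOmega m' d} (h : ReflTransGen (LevelStep R) x y) :
    x.1 ≤ y.1 := by
  induction h with
  | refl => exact le_rfl
  | tail _ h ih => exact ih.trans (Fin.le_def.2 (by have := h.level_eq; omega))

theorem levelStep_reflTransGen_eq {x y : QOmega m' d} (h : ReflTransGen (LevelStep R) x y)
    (hxy : x.1 = y.1) : x = y := by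
  rcases ReflTransGen.cases_head h with h | ⟨z, hz, hzy⟩
  · exact h
  · have h1 := Fin.le_def.1 (levelStep_reflTransGen_le hzy)
    have h2 := hz.level_eq
    rw [hxy] at h2
    omega

theorem exists_level_between {x y : QOmega m' d} (h : ReflTransGen (LevelStep R) x y)
    (i : Fin (m' + 1)) (hx : x.1 ≤ i) (hy : i ≤ y.1) :
    ∃ z, z.1 = i ∧ ReflTransGen (LevelStep R) x z ∧ ReflTransGen (LevelStep R) z y := by
  induction h with
  | refl => exact ⟨x, le_antisymm hx hy, .refl, .refl⟩
  | @tail b c hxb hbc ih =>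
    by_cases hi : i ≤ b.1
    · obtain ⟨z, hz, hxz, hzb⟩ := ih hi
      exact ⟨z, hz, hxz, hzb.tail hbc⟩
    · refine ⟨c, ?_, hxb.tail hbc, .refl⟩
      have := hbc.level_eq
      rw [Fin.le_def] at hi hy
      exact Fin.ext (by omega)

/-- Partial matchings between consecutive levels come from a segmentation. -/
theorem exists_segmentation_of_matching (hr : ∀ i j j₁ j₂, R i j j₁ → R i j j₂ → j₁ = j₂)
    (hl : ∀ i j₁ j₂ j, R i j₁ j → R i j₂ j → j₁ = j₂) :
    ∃ P : Set (Set (QOmega m' d)), IsSegmentation P ∧ ∀ i j j',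
      (∃ S ∈ P, (⟨i.castSucc, j⟩ : QOmega m' d) ∈ S ∧ (⟨i.succ, j'⟩ : QOmega m' d) ∈ S) ↔
        R i j j' := by
  let r : QOmega m' d → QOmega m' d → Prop := ReflTransGen (LevelStep R)
  let E : QOmega m' d → QOmega m' d → Prop := fun x y => r x y ∨ r y x
  have hsymm : ∀ {x y}, E x y → E y x := fun h => h.symm
  have hright : ∀ {x y z}, r x y → r x z → E y z := fun h h' =>
    ReflTransGen.total_of_right_unique (levelStep_rightUnique hr) h h'
  have hleft : ∀ {x y z}, r y x → r z x → E y z := fun h h' =>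
    (ReflTransGen.total_of_right_unique (levelStep_leftUnique hl)
      (reflTransGen_swap.2 h) (reflTransGen_swap.2 h')).symm.imp
      reflTransGen_swap.1 reflTransGen_swap.1
  have htrans : ∀ {x y z}, E x y → E y z → E x z := by
    rintro x y z (h | h) (h' | h')
    · exact Or.inl (h.trans h')
    · exact hleft h h'
    · exact hright h h'
    · exact Or.inr (h'.trans h)
  have hEeq : ∀ {x y}, E x y → x.1 = y.1 → x = y := by
    rintro x y (h | h) hxy
    · exact levelStep_reflTransGen_eq h hxy
    · exact (levelStep_reflTransGen_eq h hxy.symm).symm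
  have hEstep : ∀ {i j j'}, E ⟨i.castSucc, j⟩ ⟨i.succ, j'⟩ ↔ R i j j' := by
    intro i j j'
    refine ⟨?_, fun h => Or.inl (.single (levelStep_mk.2 h))⟩
    rintro (h | h)
    · rcases ReflTransGen.cases_head h with h | ⟨z, hz, hzy⟩
      · have := congrArg (fun x : QOmega m' d => (x.1 : ℕ)) h
        simp at this
      · have h1 := hz.level_eq
        have := levelStep_reflTransGen_eq hzy (Fin.ext (by simpa using h1))
        subst this
        exact levelStep_mk.1 hz
    · have := Fin.le_def.1 (levelStep_reflTransGen_le h)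
      simp at this
  refine ⟨Set.range fun x => {y | E x y}, ⟨?_, fun x => ?_⟩, fun i j j' => ?_⟩
  · rintro _ ⟨x, rfl⟩
    refine ⟨⟨x, Or.inl .refl⟩, fun i j j' h h' => ?_, ?_⟩
    · exact eq_of_heq (Sigma.mk.inj (hEeq (htrans (hsymm h) h') rfl)).2
    · rintro i₁ i₂ i₃ ⟨j₁, h₁⟩ ⟨j₂, h₂⟩ h13 h32
      have h12 : r ⟨i₁, j₁⟩ ⟨i₂, j₂⟩ := by
        rcases htrans (hsymm h₁) h₂ with h | h
        · exact h
        · have h21 : i₂ ≤ i₁ := levelStep_reflTransGen_le h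
          have := levelStep_reflTransGen_eq h (le_antisymm h21 (h13.trans h32))
          rw [this]
      obtain ⟨⟨i, j⟩, rfl, hz, -⟩ := exists_level_between h12 i₃ h13 h32
      exact ⟨j, htrans h₁ (Or.inl hz)⟩
  · refine ⟨{y | E x y}, ⟨⟨x, rfl⟩, Or.inl .refl⟩, ?_⟩
    rintro _ ⟨⟨y, rfl⟩, hy⟩
    ext z
    exact ⟨fun h => htrans (hsymm hy) h, fun h => htrans hy h⟩
  · rw [← hEstep]
    constructor
    · rintro ⟨_, ⟨x, rfl⟩, h, h'⟩
      exact htrans (hsymm h) h'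
    · intro h
      exact ⟨_, ⟨⟨i.castSucc, j⟩, rfl⟩, Or.inl .refl, h⟩

end PartialMatching

section Flag

variable {m' : ℕ} {d : Fin (m' + 1) → ℕ}

/-- The filtration of each level of a representation by the subspaces of vectors that die at a
given later level, or reach the top level inside a given step of the flag defined by `χ`. The
first kind is indexed by integers below the lower bound `K` of `χ`. -/
def levelFlag (f : QRep m' d) (χ : Fin (d (Fin.last m')) → ℤ) (K : ℤ) (a : Fin (m' + 1)) :
    ℤ → Submodule ℂ (Fin (d a) → ℂ) :=
  Fin.reverseInduction (motive := fun a => ℤ → Submodule ℂ (Fin (d a) → ℂ))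
    (fun c => coordSubspace ℂ fun j => χ j ≤ c)
    (fun i U c => if c < K + (i : ℕ) - m' then ⊥ else (U c).comap (Matrix.toLin' (f i))) a

variable {f : QRep m' d} {χ : Fin (d (Fin.last m')) → ℤ} {K : ℤ}

theorem levelFlag_last (c : ℤ) :
    levelFlag f χ K (Fin.last m') c = coordSubspace ℂ fun j => χ j ≤ c := by
  simp [levelFlag]

theorem levelFlag_castSucc (i : Fin m') (c : ℤ) :
    levelFlag f χ K i.castSucc c = if c < K + (i : ℕ) - m' then ⊥ else
      (levelFlag f χ K i.succ c).comap (Matrix.toLin' (f i)) := by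
  simp [levelFlag]

theorem levelFlag_eq_bot (hK : ∀ j, K ≤ χ j) (a : Fin (m' + 1)) (c : ℤ)
    (hc : c < K + (a : ℕ) - m') : levelFlag f χ K a c = ⊥ := by
  induction a using Fin.lastCases with
  | last =>
    rw [levelFlag_last, eq_bot_iff]
    intro v hv
    rw [Submodule.mem_bot]
    ext j
    by_contra h
    have h1 := hv j h
    have h2 := hK j
    simp only [Fin.val_last] at hc
    omega
  | cast i =>
    rw [levelFlag_castSucc, if_pos (by simpa using hc)]

theorem levelFlag_mono (a : Fin (m' + 1)) : Monotone (levelFlag f χ K a) := by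
  induction a using Fin.reverseInduction with
  | last =>
    intro c c' h
    rw [levelFlag_last, levelFlag_last]
    exact fun v hv j hj => (hv j hj).trans h
  | cast i ih =>
    intro c c' h
    rw [levelFlag_castSucc, levelFlag_castSucc]
    split_ifs with h1 h2
    · exact le_rfl
    · exact bot_le
    · omega
    · exact Submodule.comap_mono (ih h)

theorem levelFlag_castSucc_eq_ker (hK : ∀ j, K ≤ χ j) (i : Fin m') :
    levelFlag f χ K i.castSucc (K + (i : ℕ) - m') = LinearMap.ker (Matrix.toLin' (f i)) := by
  rw [levelFlag_castSucc, if_neg (lt_irrefl _), levelFlag_eq_bot hK, Submodule.comap_bot]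
  simp

theorem exists_comap_levelFlag_eq (hK : ∀ j, K ≤ χ j) (i : Fin m') (c : ℤ) :
    ∃ c', (levelFlag f χ K i.succ c).comap (Matrix.toLin' (f i)) =
      levelFlag f χ K i.castSucc c' := by
  by_cases h : c < K + (i : ℕ) - m'
  · refine ⟨K + (i : ℕ) - m', ?_⟩
    rw [levelFlag_castSucc_eq_ker hK, levelFlag_eq_bot hK, Submodule.comap_bot]
    simp
    omega
  · exact ⟨c, by rw [levelFlag_castSucc, if_neg h]⟩

theorem isChain_range_levelFlag (a : Fin (m' + 1)) :
    IsChain (· ≤ ·) (Set.range (levelFlag f χ K a)) :=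
  (levelFlag_mono a).isChain_range

/-- Every representation has bases of its levels, adapted to the flag on top, such that basis
vectors map to zero or to distinct basis vectors. -/
theorem exists_adapted_bases (f : QRep m' d) (χ : Fin (d (Fin.last m')) → ℤ) :
    ∃ T : ∀ a, Set (Fin (d a) → ℂ),
      (∀ a, LinearIndepOn ℂ id (T a) ∧ Submodule.span ℂ (T a) = ⊤) ∧
      (∀ c, coordSubspace ℂ (fun j => χ j ≤ c) ≤
        Submodule.span ℂ (T (Fin.last m') ∩ coordSubspace ℂ fun j => χ j ≤ c)) ∧
      ∀ i : Fin m', (∀ t ∈ T i.castSucc, f i *ᵥ t ≠ 0 → f i *ᵥ t ∈ T i.succ) ∧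
        ∀ t ∈ T i.castSucc, ∀ t' ∈ T i.castSucc, f i *ᵥ t ≠ 0 → f i *ᵥ t = f i *ᵥ t' → t = t' := by
  obtain ⟨K, hK⟩ := (Set.finite_range χ).bddBelow
  replace hK : ∀ j, K ≤ χ j := fun j => hK ⟨j, rfl⟩
  let B : Fin (m' + 1) → Type := fun a => {T : Set (Fin (d a) → ℂ) //
    LinearIndepOn ℂ id T ∧ Submodule.span ℂ T = ⊤ ∧
      ∀ U ∈ Set.range (levelFlag f χ K a), U ≤ Submodule.span ℂ (T ∩ U)}
  have hzero : Nonempty (B 0) := by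
    obtain ⟨T, -, hT, hC⟩ := exists_adapted_extension (insert ⊤ (Set.range (levelFlag f χ K 0)))
      ((isChain_range_levelFlag 0).insert fun U _ _ => Or.inr le_top) ∅
      (linearIndepOn_empty _ _) (by simp)
    refine ⟨T, hT, top_le_iff.1 ?_, fun U hU => hC U (Set.mem_insert_of_mem _ hU)⟩
    simpa using hC ⊤ (Set.mem_insert _ _)
  have hstep : ∀ (i : Fin m') (T : B i.castSucc), ∃ T' : B i.succ,
      (∀ t ∈ T.1, f i *ᵥ t ≠ 0 → f i *ᵥ t ∈ T'.1) ∧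
      ∀ t ∈ T.1, ∀ t' ∈ T.1, f i *ᵥ t ≠ 0 → f i *ᵥ t = f i *ᵥ t' → t = t' := by
    rintro i ⟨T, hT, hspan, hC⟩
    obtain ⟨T', h1, h2, h3, h4, h5⟩ := exists_adapted_image (Matrix.toLin' (f i)) T hT hspan
      (hC _ ⟨_, levelFlag_castSucc_eq_ker hK i⟩) (Set.range (levelFlag f χ K i.succ))
      (isChain_range_levelFlag _) (by
        rintro _ ⟨c, rfl⟩
        obtain ⟨c', hc'⟩ := exists_comap_levelFlag_eq (f := f) hK i c
        exact hC _ ⟨c', hc'.symm⟩)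
    exact ⟨⟨T', h1, h2, h3⟩, h4, h5⟩
  choose next hnext using hstep
  let T : ∀ a, B a := fun a => Fin.induction (motive := B) hzero.some next a
  refine ⟨fun a => (T a).1, fun a => ⟨(T a).2.1, (T a).2.2.1⟩, fun c => ?_, fun i => ?_⟩
  · exact (T (Fin.last m')).2.2.2 _ ⟨c, levelFlag_last c⟩
  · have : T i.succ = next i (T i.castSucc) := Fin.induction_succ _ _ _
    beta_reduce
    rw [this]
    exact hnext i (T i.castSucc)

end Flag

section Surjectivity

variable {m' : ℕ} {d : Fin (m' + 1) → ℕ}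

theorem qAct_eq_iff {g : QGroup m' d} {f f' : QRep m' d} :
    qAct g f = f' ↔ ∀ i, (g i.succ).1 * f i = f' i * (g i.castSucc).1 := by
  have hq : ∀ i, qAct g f i = (g i.succ).1 * f i * (g i.castSucc)⁻¹.1 := fun _ => rfl
  rw [funext_iff]
  refine forall_congr' fun i => ⟨fun h => ?_, fun h => ?_⟩
  · rw [← h, hq, Matrix.mul_assoc _ _ (g i.castSucc).1, Units.inv_mul, Matrix.mul_one]
  · rw [hq, h, Matrix.mul_assoc, Units.mul_inv, Matrix.mul_one]

/-- A basis of `ℂ^n` adapted to the flag defined by `χ` can be indexed compatibly with `χ`. -/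
theorem exists_equiv_of_adapted_flag {n : ℕ} (χ : Fin n → ℤ) (T : Set (Fin n → ℂ)) [Finite T]
    (hT : LinearIndepOn ℂ id T)
    (hχ : ∀ c, coordSubspace ℂ (fun j => χ j ≤ c) ≤
      Submodule.span ℂ (T ∩ coordSubspace ℂ fun j => χ j ≤ c)) :
    ∃ e : Fin n ≃ T, ∀ l k, (e l).1 k ≠ 0 → χ k ≤ χ l := by
  have hne : ∀ t : T, (Finset.univ.filter fun k => t.1 k ≠ 0).Nonempty := by
    intro t
    obtain ⟨k, hk⟩ := Function.ne_iff.1 (hT.ne_zero (i := t.1) t.2)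
    exact ⟨k, by simpa using hk⟩
  let label : T → ℤ := fun t => (Finset.univ.filter fun k => t.1 k ≠ 0).sup' (hne t) χ
  have hlabel : ∀ t c, label t ≤ c ↔ t.1 ∈ coordSubspace ℂ fun j => χ j ≤ c := by
    intro t c
    simp [label, mem_coordSubspace]
  have hcard : ∀ c, Nat.card {j // χ j ≤ c} = Nat.card {t // label t ≤ c} := by
    intro c
    simp_rw [hlabel, ← finrank_eq_card_of_adapted T hT _ (hχ c)]
    exact (finrank_coordSubspace _).symm
  obtain ⟨e, he⟩ := exists_equiv_of_card_fiber χ label fun c => by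
    rw [card_fiber_int, card_fiber_int, hcard, hcard]
  exact ⟨e, fun l k hk => (hlabel (e l) (χ l)).1 (he l).le k hk⟩

theorem exists_segRep_sameOrbit (χ : Fin (d (Fin.last m')) → ℤ) (f : QRep m' d) :
    ∃ P : Set (Set (QOmega m' d)), IsSegmentation P ∧ SameOrbit χ (segRep P) f := by
  obtain ⟨T, hT, hχ, hf⟩ := exists_adapted_bases f χ
  have hfin : ∀ a, Finite (T a) := fun a => (hT a).1.setFinite
  have hcard : ∀ a, Nonempty (Fin (d a) ≃ T a) := by
    intro a
    have h := finrank_eq_card_of_adapted (T a) (hT a).1 ⊤ (by simp [(hT a).2])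
    rw [finrank_top, Module.finrank_fin_fun] at h
    have h' : Nat.card {t : T a // t.1 ∈ (⊤ : Submodule ℂ (Fin (d a) → ℂ))} = Nat.card (T a) :=
      Nat.card_congr (Equiv.subtypeUnivEquiv fun _ => Submodule.mem_top)
    exact Finite.card_eq.1 ((Nat.card_fin _).trans (h.trans h'))
  obtain ⟨e₁, he₁⟩ := exists_equiv_of_adapted_flag χ (T (Fin.last m')) (hT _).1 hχ
  obtain ⟨e, he⟩ : ∃ e : ∀ a, Fin (d a) ≃ T a, e (Fin.last m') = e₁ :=
    ⟨fun a => Fin.lastCases (motive := fun a => Fin (d a) ≃ T a) e₁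
      (fun i => (hcard i.castSucc).some) a, Fin.lastCases_last⟩
  obtain ⟨P, hP, hPR⟩ := exists_segmentation_of_matching
    (R := fun i j j' => f i *ᵥ (e i.castSucc j).1 = (e i.succ j').1)
    (fun i j j₁ j₂ h₁ h₂ => (e i.succ).injective (Subtype.ext (h₁.symm.trans h₂)))
    (fun i j₁ j₂ j h₁ h₂ => (e i.castSucc).injective (Subtype.ext ((hf i).2 _ (e _ j₁).2 _
      (e _ j₂).2 (h₁ ▸ (hT _).1.ne_zero (e i.succ j).2) (h₁.trans h₂.symm))))
  have hunit : ∀ a, IsUnit (Matrix.of fun k l => (e a l).1 k) := fun a =>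
    Matrix.linearIndependent_cols_iff_isUnit.1
      (LinearIndependent.comp (hT a).1 (e a) (e a).injective)
  refine ⟨P, hP, fun a => (hunit a).unit, ?_, qAct_eq_iff.2 fun i => ?_⟩
  · intro k l hkl
    by_contra h
    rw [← he] at he₁
    exact absurd (he₁ l k h) (not_le.2 hkl)
  · ext k j
    have hright : (f i * (hunit i.castSucc).unit.1) k j = (f i *ᵥ (e i.castSucc j).1) k := rfl
    rw [hright, Matrix.mul_apply]
    simp only [segRep, hPR, Matrix.of_apply, IsUnit.unit_spec, mul_ite, mul_one, mul_zero]
    by_cases h0 : f i *ᵥ (e i.castSucc j).1 = 0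
    · rw [h0]
      refine Finset.sum_eq_zero fun j' _ => if_neg fun h => ?_
      exact (hT _).1.ne_zero (e i.succ j').2 h.symm
    · obtain ⟨j', hj'⟩ := (e i.succ).surjective ⟨_, (hf i).1 _ (e i.castSucc j).2 h0⟩
      have hj'' := (congrArg Subtype.val hj').symm
      rw [Finset.sum_eq_single j', if_pos hj'', ← hj'']
      · intro b _ hb
        exact if_neg fun h => hb ((e i.succ).injective (Subtype.ext (h.symm.trans hj'')))
      · simp

end Surjectivity

section Segmentation

variable {m' : ℕ} {d : Fin (m' + 1) → ℕ} {P : Set (Set (QOmega m' d))}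

/-- The subsegment containing a given element. -/
def IsSegmentation.part (hP : IsSegmentation P) (x : QOmega m' d) : P :=
  ⟨(hP.2 x).choose, (hP.2 x).choose_spec.1.1⟩

theorem IsSegmentation.mem_part (hP : IsSegmentation P) (x : QOmega m' d) : x ∈ (hP.part x).1 :=
  (hP.2 x).choose_spec.1.2

theorem IsSegmentation.part_eq (hP : IsSegmentation P) {x : QOmega m' d} {S : P}
    (hx : x ∈ S.1) : hP.part x = S :=
  Subtype.ext ((hP.2 x).choose_spec.2 S.1 ⟨S.2, hx⟩).symm

theorem IsSegmentation.part_injective (hP : IsSegmentation P) {a : Fin (m' + 1)}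
    {j j' : Fin (d a)} (h : hP.part ⟨a, j⟩ = hP.part ⟨a, j'⟩) : j = j' :=
  (hP.1 _ (hP.part ⟨a, j'⟩).2).2.1 a j j' (h ▸ hP.mem_part _) (hP.mem_part _)

open Classical in
theorem IsSegmentation.segRep_apply (hP : IsSegmentation P) (i : Fin m') (j' : Fin (d i.succ))
    (j : Fin (d i.castSucc)) :
    segRep P i j' j = if hP.part ⟨i.castSucc, j⟩ = hP.part ⟨i.succ, j'⟩ then 1 else 0 := by
  have h : (∃ S ∈ P, (⟨i.castSucc, j⟩ : QOmega m' d) ∈ S ∧ (⟨i.succ, j'⟩ : QOmega m' d) ∈ S) ↔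
      hP.part ⟨i.castSucc, j⟩ = hP.part ⟨i.succ, j'⟩ := by
    constructor
    · rintro ⟨S, hS, h, h'⟩
      rw [hP.part_eq (S := ⟨S, hS⟩) h, hP.part_eq (S := ⟨S, hS⟩) h']
    · intro h
      exact ⟨_, (hP.part ⟨i.succ, j'⟩).2, h ▸ hP.mem_part _, hP.mem_part _⟩
  simp only [segRep, Matrix.of_apply, h]

theorem SameMultisegment.sameOrbit {P' : Set (Set (QOmega m' d))}
    {χ : Fin (d (Fin.last m')) → ℤ} (hP : IsSegmentation P) (hP' : IsSegmentation P')
    (h : SameMultisegment χ P P') : SameOrbit χ (segRep P) (segRep P') := by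
  obtain ⟨φ, hφ⟩ := h
  have hex : ∀ a (j : Fin (d a)), ∃ j', (⟨a, j'⟩ : QOmega m' d) ∈ (φ (hP.part ⟨a, j⟩)).1 := by
    intro a j
    have : a ∈ levelsOf (hP.part ⟨a, j⟩).1 := ⟨j, hP.mem_part _⟩
    rwa [(hφ _).1] at this
  choose s hs using hex
  have hpart : ∀ a j, hP'.part ⟨a, s a j⟩ = φ (hP.part ⟨a, j⟩) := fun a j => hP'.part_eq (hs a j)
  have hinj : ∀ a, Function.Injective (s a) := fun a j j' hjj' =>
    hP.part_injective (φ.injective (by rw [← hpart, ← hpart, hjj']))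
  let σ : ∀ a, Equiv.Perm (Fin (d a)) := fun a =>
    Equiv.ofBijective (s a) (Finite.injective_iff_bijective.1 (hinj a))
  have hσ : ∀ a j, σ a j = s a j := fun _ _ => rfl
  have hunit : ∀ a, IsUnit (Matrix.of fun k l => if k = s a l then (1 : ℂ) else 0) := by
    intro a
    have : (Matrix.of fun k l => if k = s a l then (1 : ℂ) else 0) =
        (σ a)⁻¹.permMatrix ℂ := by
      ext k l
      have : k = s a l ↔ l = (σ a).symm k := by rw [Equiv.eq_symm_apply, hσ, eq_comm]
      simp [PEquiv.toMatrix_apply, this, eq_comm, Equiv.Perm.inv_def]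
    rw [this, Matrix.isUnit_iff_isUnit_det, Matrix.det_permutation]
    exact ((Equiv.Perm.sign (σ a)⁻¹).isUnit.map (Int.castRingHom ℂ))
  refine ⟨fun a => (hunit a).unit, ?_, qAct_eq_iff.2 fun i => ?_⟩
  · intro k l hkl
    simp only [IsUnit.unit_spec, Matrix.of_apply, ite_eq_right_iff, one_ne_zero, imp_false]
    rintro rfl
    exact absurd ((hφ _).2 l (s _ l) (hP.mem_part _) (hs _ l)) hkl.ne
  · ext k j
    obtain ⟨k, rfl⟩ := (σ i.succ).surjective k
    simp only [Matrix.mul_apply, IsUnit.unit_spec, Matrix.of_apply, hσ, (hinj _).eq_iff,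
      ite_mul, mul_ite, one_mul, mul_one, zero_mul, mul_zero, Finset.sum_ite_eq,
      Finset.sum_ite_eq', Finset.mem_univ, if_true]
    rw [hP.segRep_apply, hP'.segRep_apply, hpart, hpart]
    simp only [φ.injective.eq_iff]

end Segmentation

section Invariants

variable {m' : ℕ} {d : Fin (m' + 1) → ℕ} {χ : Fin (d (Fin.last m')) → ℤ} {K : ℤ}

open Classical in
/-- The end of a subsegment, encoded as an integer: the flavor `χ j` when it reaches the top level
at `j`, and otherwise an integer below the lower bound `K` of `χ` determined by its last level. -/
def segCode (χ : Fin (d (Fin.last m')) → ℤ) (K : ℤ) (S : Set (QOmega m' d)) : ℤ :=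
  if h : ∃ j, (⟨Fin.last m', j⟩ : QOmega m' d) ∈ S then χ h.choose
  else K + (sSup (levelsOf S) : Fin (m' + 1)).val - m'

variable {S S' : Set (QOmega m' d)}

theorem IsSubsegment.levelsOf_nonempty (hS : IsSubsegment S) : (levelsOf S).Nonempty := by
  obtain ⟨⟨a, j⟩, h⟩ := hS.1
  exact ⟨a, j, h⟩

theorem IsSubsegment.levelsOf_eq_Icc (hS : IsSubsegment S) :
    levelsOf S = Set.Icc (sInf (levelsOf S)) (sSup (levelsOf S)) := by
  ext a
  exact ⟨fun h => ⟨sInf_le h, le_sSup h⟩, fun h => hS.2.2 _ _ a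
    (hS.levelsOf_nonempty.csInf_mem (Set.toFinite _))
    (hS.levelsOf_nonempty.csSup_mem (Set.toFinite _)) h.1 h.2⟩

theorem IsSubsegment.segCode_of_last (hS : IsSubsegment S) {j : Fin (d (Fin.last m'))}
    (hj : (⟨Fin.last m', j⟩ : QOmega m' d) ∈ S) : segCode χ K S = χ j := by
  have h : ∃ j, (⟨Fin.last m', j⟩ : QOmega m' d) ∈ S := ⟨j, hj⟩
  rw [segCode, dif_pos h, hS.2.1 _ _ _ h.choose_spec hj]

theorem segCode_of_last_notMem (h : Fin.last m' ∉ levelsOf S) :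
    segCode χ K S = K + (sSup (levelsOf S) : Fin (m' + 1)).val - m' :=
  dif_neg h

theorem IsSubsegment.segCode_of_succ_notMem (hS : IsSubsegment S) {i : Fin m'}
    (hi : i.castSucc ∈ levelsOf S) (hi' : i.succ ∉ levelsOf S) :
    segCode χ K S = K + (i : ℕ) - m' := by
  have hlt : ∀ a ∈ levelsOf S, a ≤ i.castSucc := by
    intro a ha
    by_contra! h
    exact hi' (hS.2.2 _ _ _ hi ha i.castSucc_lt_succ.le (Fin.castSucc_lt_iff_succ_le.1 h))
  rw [segCode_of_last_notMem fun h => hi' (hS.2.2 _ _ _ hi h i.castSucc_lt_succ.le (Fin.le_last _)),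
    le_antisymm (sSup_le hlt) (le_sSup hi)]
  rfl

theorem IsSubsegment.le_segCode (hS : IsSubsegment S) (hK : ∀ j, K ≤ χ j) {a : Fin (m' + 1)}
    (ha : a ∈ levelsOf S) : K + (a : ℕ) - m' ≤ segCode χ K S := by
  by_cases h : Fin.last m' ∈ levelsOf S
  · obtain ⟨j, hj⟩ := h
    rw [hS.segCode_of_last hj]
    have := hK j
    have := a.is_le
    omega
  · rw [segCode_of_last_notMem h]
    have := Fin.le_def.1 (le_sSup ha)
    omega

theorem IsSubsegment.segCode_lt (hS : IsSubsegment S) (h : Fin.last m' ∉ levelsOf S) :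
    segCode χ K S < K := by
  rw [segCode_of_last_notMem h]
  have h1 := hS.levelsOf_nonempty.csSup_mem (Set.toFinite _)
  have h2 : (sSup (levelsOf S) : Fin (m' + 1)) < Fin.last m' :=
    lt_of_le_of_ne (Fin.le_last _) fun h' => h (h' ▸ h1)
  have h3 := Fin.lt_def.1 h2
  rw [Fin.val_last] at h3
  omega

theorem IsSubsegment.le_segCode_iff (hS : IsSubsegment S) (hK : ∀ j, K ≤ χ j) :
    K ≤ segCode χ K S ↔ Fin.last m' ∈ levelsOf S := by
  refine ⟨fun h => ?_, fun h => ?_⟩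
  · by_contra h'
    exact absurd (hS.segCode_lt h') (not_lt.2 h)
  · simpa using hS.le_segCode hK h

theorem IsSubsegment.levelsOf_eq_of_segCode_eq (hS : IsSubsegment S) (hS' : IsSubsegment S')
    (hK : ∀ j, K ≤ χ j) (hstart : sInf (levelsOf S) = sInf (levelsOf S'))
    (hcode : segCode χ K S = segCode χ K S') : levelsOf S = levelsOf S' := by
  rw [hS.levelsOf_eq_Icc, hS'.levelsOf_eq_Icc, hstart]
  congr 1
  have hiff := (hS.le_segCode_iff hK).symm.trans (hcode ▸ hS'.le_segCode_iff hK)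
  by_cases h : Fin.last m' ∈ levelsOf S
  · rw [le_antisymm (Fin.le_last _) (le_sSup h),
      le_antisymm (Fin.le_last _) (le_sSup (hiff.1 h))]
  · rw [segCode_of_last_notMem h, segCode_of_last_notMem (mt hiff.2 h)] at hcode
    exact Fin.ext (by omega)

variable {P P' : Set (Set (QOmega m' d))}

theorem IsSegmentation.levelFlag_segRep (hP : IsSegmentation P) (hK : ∀ j, K ≤ χ j)
    (a : Fin (m' + 1)) (c : ℤ) :
    levelFlag (segRep P) χ K a c =
      coordSubspace ℂ fun j => segCode χ K (hP.part ⟨a, j⟩).1 ≤ c := by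
  have hsub : ∀ x, IsSubsegment (hP.part x).1 := fun x => hP.1 _ (hP.part x).2
  induction a using Fin.reverseInduction with
  | last =>
    rw [levelFlag_last]
    congr 1
    ext j
    rw [(hsub _).segCode_of_last (hP.mem_part _)]
  | cast i ih =>
    rw [levelFlag_castSucc, ih]
    split_ifs with hc
    · refine (eq_bot_iff.2 fun v hv => ?_).symm
      rw [Submodule.mem_bot]
      ext j
      by_contra h
      have h1 := hv j h
      have h2 := (hsub ⟨i.castSucc, j⟩).le_segCode hK ⟨j, hP.mem_part _⟩
      rw [Fin.val_castSucc] at h2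
      omega
    · ext v
      rw [Submodule.mem_comap, Matrix.toLin'_apply, mem_coordSubspace, mem_coordSubspace]
      constructor
      · intro h j hj
        by_cases hs : i.succ ∈ levelsOf (hP.part ⟨i.castSucc, j⟩).1
        · obtain ⟨j', hj'⟩ := hs
          have hpart := hP.part_eq hj'
          rw [← hpart]
          refine h j' ?_
          rw [Matrix.mulVec, dotProduct, Finset.sum_eq_single j]
          · rwa [hP.segRep_apply, if_pos hpart.symm, one_mul]
          · intro b _ hb
            rw [hP.segRep_apply, if_neg, zero_mul]
            exact fun hb' => hb (hP.part_injective (hb'.trans hpart))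
          · simp
        · rw [(hsub _).segCode_of_succ_notMem ⟨j, hP.mem_part _⟩ hs]
          omega
      · intro h j' hj'
        rw [Matrix.mulVec, dotProduct] at hj'
        obtain ⟨j, -, hj⟩ := Finset.exists_ne_zero_of_sum_ne_zero hj'
        rw [hP.segRep_apply] at hj
        have hpart : hP.part ⟨i.castSucc, j⟩ = hP.part ⟨i.succ, j'⟩ := by
          by_contra hne
          simp [hne] at hj
        rw [← hpart]
        exact h j (right_ne_zero_of_mul hj)

theorem mulVec_mem_levelFlag {f f' : QRep m' d} {g : QGroup m' d}
    (hg : InParabolic χ (g (Fin.last m')).1) (hgf : qAct g f = f') (a : Fin (m' + 1)) (c : ℤ)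
    (v : Fin (d a) → ℂ) (hv : v ∈ levelFlag f χ K a c) :
    (g a).1 *ᵥ v ∈ levelFlag f' χ K a c := by
  induction a using Fin.reverseInduction with
  | last =>
    rw [levelFlag_last, mem_coordSubspace] at hv ⊢
    intro k hk
    rw [Matrix.mulVec, dotProduct] at hk
    obtain ⟨l, -, hl⟩ := Finset.exists_ne_zero_of_sum_ne_zero hk
    refine le_trans ?_ (hv l (right_ne_zero_of_mul hl))
    by_contra! h
    exact left_ne_zero_of_mul hl (hg k l h)
  | cast i ih =>
    rw [levelFlag_castSucc] at hv ⊢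
    split_ifs at hv ⊢ with hc
    · rw [Submodule.mem_bot] at hv ⊢
      rw [hv, Matrix.mulVec_zero]
    · rw [Submodule.mem_comap, Matrix.toLin'_apply] at hv ⊢
      rw [Matrix.mulVec_mulVec, ← qAct_eq_iff.1 hgf, ← Matrix.mulVec_mulVec]
      exact ih _ hv

theorem SameOrbit.finrank_levelFlag_le {f f' : QRep m' d} (h : SameOrbit χ f f')
    (a : Fin (m' + 1)) (c : ℤ) :
    Module.finrank ℂ (levelFlag f χ K a c) ≤ Module.finrank ℂ (levelFlag f' χ K a c) := by
  obtain ⟨g, hg, hgf⟩ := h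
  have hmem : ∀ v ∈ levelFlag f χ K a c, Matrix.toLin' (g a).1 v ∈ levelFlag f' χ K a c :=
    fun v hv => by simpa using mulVec_mem_levelFlag hg hgf a c v hv
  refine LinearMap.finrank_le_finrank_of_injective
    (f := (Matrix.toLin' (g a).1).restrict hmem) fun v w hvw => Subtype.ext ?_
  have h := congrArg Subtype.val hvw
  simp only [LinearMap.coe_restrict_apply, Matrix.toLin'_apply] at h
  exact Matrix.mulVec_injective_of_isUnit (g a).isUnit h

theorem sameOrbit_equivalence (χ : Fin (d (Fin.last m')) → ℤ) :
    Equivalence (SameOrbit χ : QRep m' d → QRep m' d → Prop) where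
  refl f := ⟨1, fun k l h => Matrix.one_apply_ne (by rintro rfl; exact lt_irrefl _ h),
    qAct_eq_iff.2 fun i => by simp⟩
  symm := by
    rintro f f' ⟨g, hg, hgf⟩
    refine ⟨g⁻¹, ?_, qAct_eq_iff.2 fun i => ?_⟩
    · have hinv := (g (Fin.last m')).invertible
      have : Matrix.BlockTriangular ((g (Fin.last m')).1⁻¹) χ :=
        Matrix.blockTriangular_inv_of_blockTriangular (fun k l h => hg k l h)
      rw [← Matrix.coe_units_inv] at this
      exact fun k l h => this h
    · have h := qAct_eq_iff.1 hgf i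
      calc (g i.succ)⁻¹.1 * f' i
          = (g i.succ)⁻¹.1 * (f' i * (g i.castSucc).1) * (g i.castSucc)⁻¹.1 := by
            rw [Matrix.mul_assoc, Matrix.mul_assoc, Units.mul_inv, Matrix.mul_one]
        _ = f i * (g i.castSucc)⁻¹.1 := by
            rw [← h, ← Matrix.mul_assoc, Units.inv_mul, Matrix.one_mul]
  trans := by
    rintro f f' f'' ⟨g, hg, hgf⟩ ⟨g', hg', hgf'⟩
    refine ⟨g' * g, ?_, qAct_eq_iff.2 fun i => ?_⟩
    · have := Matrix.BlockTriangular.mul (b := χ) (fun k l h => hg' k l h) (fun k l h => hg k l h)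
      exact fun k l h => this h
    · rw [Pi.mul_apply, Pi.mul_apply, Units.val_mul, Units.val_mul, Matrix.mul_assoc,
        qAct_eq_iff.1 hgf, ← Matrix.mul_assoc, qAct_eq_iff.1 hgf', Matrix.mul_assoc]

theorem IsSegmentation.ncard_level_code (hP : IsSegmentation P) (a : Fin (m' + 1)) (c : ℤ) :
    {S : P | a ∈ levelsOf S.1 ∧ segCode χ K S.1 = c}.ncard =
      Nat.card {j // segCode χ K (hP.part ⟨a, j⟩).1 = c} := by
  symm
  refine Nat.card_eq_of_bijective (fun j => ⟨hP.part ⟨a, j.1⟩, ⟨j.1, hP.mem_part _⟩, j.2⟩)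
    ⟨fun j j' h => Subtype.ext (hP.part_injective (congrArg Subtype.val h)), ?_⟩
  rintro ⟨S, ⟨j, hj⟩, hc⟩
  have h := hP.part_eq hj
  exact ⟨⟨j, h ▸ hc⟩, Subtype.ext h⟩

theorem IsSegmentation.ncard_start_code_zero (hP : IsSegmentation P) (c : ℤ) :
    {S : P | sInf (levelsOf S.1) = 0 ∧ segCode χ K S.1 = c}.ncard =
      {S : P | 0 ∈ levelsOf S.1 ∧ segCode χ K S.1 = c}.ncard := by
  congr 1
  ext S
  refine and_congr_left fun _ => ⟨fun h => ?_, fun h => ?_⟩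
  · exact h ▸ (hP.1 _ S.2).levelsOf_nonempty.csInf_mem (Set.toFinite _)
  · exact le_antisymm (sInf_le h) (Fin.zero_le _)

theorem IsSegmentation.ncard_start_code_succ (hP : IsSegmentation P) (hK : ∀ j, K ≤ χ j)
    (i : Fin m') (c : ℤ) :
    {S : P | sInf (levelsOf S.1) = i.succ ∧ segCode χ K S.1 = c}.ncard =
      if c ≤ K + (i : ℕ) - m' then 0 else
        {S : P | i.succ ∈ levelsOf S.1 ∧ segCode χ K S.1 = c}.ncard -
          {S : P | i.castSucc ∈ levelsOf S.1 ∧ segCode χ K S.1 = c}.ncard := by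
  have hsub : ∀ S : P, IsSubsegment S.1 := fun S => hP.1 _ S.2
  have hmem : ∀ S : P, sInf (levelsOf S.1) ∈ levelsOf S.1 := fun S =>
    (hsub S).levelsOf_nonempty.csInf_mem (Set.toFinite _)
  split_ifs with hc
  · rw [Set.ncard_eq_zero]
    refine Set.eq_empty_of_forall_notMem ?_
    rintro S ⟨h, rfl⟩
    have := (hsub S).le_segCode hK (h ▸ hmem S)
    rw [Fin.val_succ] at this
    omega
  · rw [← Set.ncard_sdiff]
    · congr 1
      ext S
      simp only [Set.mem_sdiff, Set.mem_ofPred_eq]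
      constructor
      · rintro ⟨h, h'⟩
        refine ⟨⟨h ▸ hmem S, h'⟩, fun h'' => ?_⟩
        have := sInf_le h''.1
        rw [h] at this
        exact absurd i.castSucc_lt_succ (not_lt.2 this)
      · rintro ⟨⟨h, h'⟩, h''⟩
        refine ⟨le_antisymm (sInf_le h) ?_, h'⟩
        by_contra! hlt
        exact h'' ⟨(hsub S).2.2 _ _ _ (hmem S) h (Fin.le_castSucc_iff.2 hlt)
          i.castSucc_lt_succ.le, h'⟩
    · rintro S ⟨h, h'⟩
      refine ⟨?_, h'⟩
      by_contra hs
      have := (hsub S).segCode_of_succ_notMem (χ := χ) (K := K) h hs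
      omega

theorem SameOrbit.sameMultisegment (hP : IsSegmentation P) (hP' : IsSegmentation P')
    (h : SameOrbit χ (segRep P) (segRep P')) : SameMultisegment χ P P' := by
  obtain ⟨K, hK⟩ := (Set.finite_range χ).bddBelow
  replace hK : ∀ j, K ≤ χ j := fun j => hK ⟨j, rfl⟩
  have hle : ∀ a c, Nat.card {j // segCode χ K (hP.part ⟨a, j⟩).1 ≤ c} =
      Nat.card {j // segCode χ K (hP'.part ⟨a, j⟩).1 ≤ c} := by
    intro a c
    rw [← finrank_coordSubspace (K := ℂ), ← finrank_coordSubspace (K := ℂ),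
      ← hP.levelFlag_segRep hK, ← hP'.levelFlag_segRep hK]
    exact le_antisymm (h.finrank_levelFlag_le a c)
      (((sameOrbit_equivalence χ).symm h).finrank_levelFlag_le a c)
  have hlevel : ∀ a c, {S : P | a ∈ levelsOf S.1 ∧ segCode χ K S.1 = c}.ncard =
      {S : P' | a ∈ levelsOf S.1 ∧ segCode χ K S.1 = c}.ncard := by
    intro a c
    rw [hP.ncard_level_code, hP'.ncard_level_code, card_fiber_int, card_fiber_int, hle, hle]
  obtain ⟨φ, hφ⟩ := exists_equiv_of_card_fiber
    (fun S : P => (sInf (levelsOf S.1), segCode χ K S.1))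
    (fun S : P' => (sInf (levelsOf S.1), segCode χ K S.1)) (by
      rintro ⟨a, c⟩
      simp only [Prod.mk.injEq]
      change {S : P | sInf (levelsOf S.1) = a ∧ segCode χ K S.1 = c}.ncard =
        {S : P' | sInf (levelsOf S.1) = a ∧ segCode χ K S.1 = c}.ncard
      cases a using Fin.cases with
      | zero => rw [hP.ncard_start_code_zero, hP'.ncard_start_code_zero, hlevel]
      | succ i => rw [hP.ncard_start_code_succ hK, hP'.ncard_start_code_succ hK, hlevel, hlevel])
  refine ⟨φ, fun S => ?_⟩
  obtain ⟨hstart, hcode⟩ := Prod.mk.inj (hφ S)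
  refine ⟨(hP.1 _ S.2).levelsOf_eq_of_segCode_eq (hP'.1 _ (φ S).2) hK hstart.symm hcode.symm,
    fun j j' hj hj' => ?_⟩
  rw [← (hP.1 _ S.2).segCode_of_last (χ := χ) (K := K) hj,
    ← (hP'.1 _ (φ S).2).segCode_of_last (χ := χ) (K := K) hj', hcode]

end Invariants

/-- The `G_χ`-orbits on `V` are in bijection with `χ`-flavored multisegments: every orbit
contains some `f_Σ`; `f_Σ`, `f_{Σ'}` lie in the same orbit exactly when `Σ`, `Σ'` have the
same `χ`-flavored multisegment; and hence `Σ ↦ G_χ·f_Σ` descends to a bijection from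
`χ`-flavored multisegments with the given dimension vector (equivalence classes of
segmentations of `Ω`) to the set of `G_χ`-orbits on `V`. -/
theorem orbits_biject_with_multisegments (m' : ℕ) (hm : 1 ≤ m') (d : Fin (m' + 1) → ℕ)
    (χ : Fin (d (Fin.last m')) → ℤ) (hχ : Monotone χ) :
    (∀ f : QRep m' d, ∃ P : Set (Set (QOmega m' d)), IsSegmentation P ∧
      SameOrbit χ (segRep P) f) ∧
    (∀ P P' : Set (Set (QOmega m' d)), IsSegmentation P → IsSegmentation P' →
      (SameOrbit χ (segRep P) (segRep P') ↔ SameMultisegment χ P P')) ∧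
    (∃ e : Quot (fun P P' : {P : Set (Set (QOmega m' d)) // IsSegmentation P} =>
          SameMultisegment χ P.val P'.val) ≃
        Quot (fun f f' : QRep m' d => SameOrbit χ f f'),
      ∀ P : {P : Set (Set (QOmega m' d)) // IsSegmentation P},
        e (Quot.mk _ P) = Quot.mk _ (segRep P.val)) := by
  have hiff : ∀ P P' : Set (Set (QOmega m' d)), IsSegmentation P → IsSegmentation P' →
      (SameOrbit χ (segRep P) (segRep P') ↔ SameMultisegment χ P P') := fun P P' hP hP' =>
    ⟨fun h => h.sameMultisegment hP hP', fun h => h.sameOrbit hP hP'⟩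
  refine ⟨exists_segRep_sameOrbit χ, hiff, Equiv.ofBijective
    (Quot.map (fun P => segRep P.1) fun P P' h => (hiff _ _ P.2 P'.2).2 h) ⟨?_, ?_⟩, fun P => rfl⟩
  · rintro ⟨P⟩ ⟨P'⟩ h
    exact Quot.sound ((hiff _ _ P.2 P'.2).1
      ((sameOrbit_equivalence χ).eqvGen_iff.1 (Quot.eqvGen_exact h)))
  · rintro ⟨f⟩
    obtain ⟨P, hP, h⟩ := exists_segRep_sameOrbit χ f
    exact ⟨Quot.mk _ ⟨P, hP⟩, Quot.sound h⟩

end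
end
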